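/- (Weil's lemma.) Let k be an even positive integer, let f : ℍ → ℂ be holomorphic, and let ε = [[a,b],[c,d]] be a real 2×2 matrix with det ε > 0 which is elliptic, i.e. (a+d)² < 4(ad−bc). If f|_k ε = f, then either there exists an integer n ≥ 1 such that εⁿ is a scalar matrix, or f is constant. -/

import Mathlib

open Complex UpperHalfPlane Matrix

/-- Möbius transform of `z ∈ ℍ` under a real 2×2 matrix, as a complex number. -/
noncomputable def moebius (γ : Matrix (Fin 2) (Fin 2) ℝ) (z : ℍ) : ℂ :=
  ((γ 0 0 : ℂ) * (z : ℂ) + (γ 0 1 : ℂ)) / ((γ 1 0 : ℂ) * (z : ℂ) + (γ 1 1 : ℂ))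

/-- Action of a real 2×2 matrix on the upper half-plane.  When the matrix has
positive determinant the Möbius image lies in `ℍ` and the `dite` takes the
first branch, so this agrees with the usual fractional linear action. -/
noncomputable def act (γ : Matrix (Fin 2) (Fin 2) ℝ) (z : ℍ) : ℍ :=
  if h : 0 < (moebius γ z).im then ⟨moebius γ z, h⟩ else z

/-- Weight-`k` slash action `f ∣[k] γ` with the classical normalization
`(det γ)^(k/2) (cz+d)^(-k) f(γz)` (for `k` even, `det γ > 0`). -/
noncomputable def slash (k : ℤ) (γ : Matrix (Fin 2) (Fin 2) ℝ) (f : ℍ → ℂ) : ℍ → ℂ :=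
  fun z => ((γ.det : ℂ) ^ (k / 2)) * (((γ 1 0 : ℂ) * (z : ℂ) + (γ 1 1 : ℂ)) ^ (-k)) * f (act γ z)

/-- The Hecke operator `T_n` (trivial character):
`f ∣[k] T_n = Σ_{ad = n, a,d > 0, 0 ≤ b < d} f ∣[k] [[a,b],[0,d]]`. -/
noncomputable def hecke (k : ℤ) (n : ℕ) (f : ℍ → ℂ) : ℍ → ℂ :=
  fun z => ∑ a ∈ n.divisors, ∑ b ∈ Finset.range (n / a),
    slash k !![(a : ℝ), (b : ℝ); 0, ((n / a : ℕ) : ℝ)] f z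

/-- The matrix `T = [[1,1],[0,1]]`. -/
noncomputable def Tmat : Matrix (Fin 2) (Fin 2) ℝ := !![1, 1; 0, 1]

/-- The Fricke matrix `H_N = [[0,-1],[N,0]]`. -/
noncomputable def Hmat (N : ℕ) : Matrix (Fin 2) (Fin 2) ℝ := !![0, -1; (N : ℝ), 0]

/-- The matrix `W_N = [[1,0],[N,1]]`. -/
noncomputable def Wmat (N : ℕ) : Matrix (Fin 2) (Fin 2) ℝ := !![1, 0; (N : ℝ), 1]

/-- The matrix `β(x) = [[1,x],[0,1]]`. -/
noncomputable def betaMat (x : ℝ) : Matrix (Fin 2) (Fin 2) ℝ := !![1, x; 0, 1]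

lemma denom_ne_zero_of_det_pos {γ : Matrix (Fin 2) (Fin 2) ℝ} (hdet : 0 < γ.det) {z : ℂ}
    (hz : 0 < z.im) : (γ 1 0 : ℂ) * z + (γ 1 1 : ℂ) ≠ 0 := by
  intro h
  have him : γ 1 0 = 0 := by simpa [hz.ne'] using congrArg Complex.im h
  have hre : γ 1 1 = 0 := by simpa [him] using congrArg Complex.re h
  simp [Matrix.det_fin_two, him, hre] at hdet

lemma moebius_im_pos {γ : Matrix (Fin 2) (Fin 2) ℝ} (hdet : 0 < γ.det) (z : ℍ) :
    0 < (moebius γ z).im := by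
  have hpos := Complex.normSq_pos.2 (denom_ne_zero_of_det_pos hdet z.im_pos)
  have him : (moebius γ z).im =
      γ.det * z.im / Complex.normSq ((γ 1 0 : ℂ) * z + (γ 1 1 : ℂ)) := by
    rw [moebius, Complex.div_im, ← sub_div, Matrix.det_fin_two]
    congr 1
    simp
    ring
  rw [him]
  exact div_pos (mul_pos hdet z.im_pos) hpos

lemma coe_act {γ : Matrix (Fin 2) (Fin 2) ℝ} (hdet : 0 < γ.det) (z : ℍ) :
    (act γ z : ℂ) = moebius γ z := by
  rw [act, dif_pos (moebius_im_pos hdet z)]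

/-- An elliptic matrix has a fixed point in the upper half-plane. -/
lemma exists_fixedPoint_of_elliptic {γ : Matrix (Fin 2) (Fin 2) ℝ}
    (hell : γ.trace ^ 2 < 4 * γ.det) :
    ∃ w : ℂ, 0 < w.im ∧
      (γ 0 0 : ℂ) * w + γ 0 1 = ((γ 1 0 : ℂ) * w + γ 1 1) * w := by
  rw [Matrix.trace_fin_two, Matrix.det_fin_two] at hell
  generalize γ 0 0 = a, γ 0 1 = b, γ 1 0 = c, γ 1 1 = d at *
  have hc : c ≠ 0 := by
    rintro rfl
    nlinarith [sq_nonneg (a - d)]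
  set s := √(4 * (a * d - b * c) - (a + d) ^ 2)
  have hs_pos : 0 < s := Real.sqrt_pos.2 (sub_pos.2 hell)
  have hs_sq : s ^ 2 = 4 * (a * d - b * c) - (a + d) ^ 2 := Real.sq_sqrt (sub_pos.2 hell).le
  have hc_sq : |c| ^ 2 = c ^ 2 := sq_abs c
  have hc_abs : |c| ≠ 0 := abs_ne_zero.2 hc
  refine ⟨⟨(a - d) / (2 * c), s / (2 * |c|)⟩, by positivity, ?_⟩
  have hre : c * ((a - d) / (2 * c)) = (a - d) / 2 := by field_simp
  have him : (s / (2 * |c|)) ^ 2 = s ^ 2 / (4 * c ^ 2) := by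
    rw [div_pow, mul_pow, hc_sq]; norm_num
  apply Complex.ext
  · have : c * (s / (2 * |c|)) * (s / (2 * |c|)) = s ^ 2 / (4 * c) := by
      rw [mul_assoc, ← sq, him]; field_simp
    simp only [Complex.add_re, Complex.mul_re, Complex.add_im, Complex.mul_im,
      Complex.ofReal_re, Complex.ofReal_im, zero_mul, sub_zero, add_zero]
    rw [hre, this, hs_sq]
    field_simp
    ring
  · simp only [Complex.add_re, Complex.mul_re, Complex.add_im, Complex.mul_im,
      Complex.ofReal_re, Complex.ofReal_im, zero_mul, sub_zero, add_zero]
    rw [hre]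
    linear_combination -(s / (2 * |c|)) * hre

/-- A real `2 × 2` matrix with a non-real eigenvector `(w, 1)` and a real eigenvalue is scalar. -/
lemma eq_smul_one_of_mulVec {A : Matrix (Fin 2) (Fin 2) ℝ} {w : ℂ} (hw : 0 < w.im) {r : ℝ}
    (h : A.map ((↑) : ℝ → ℂ) *ᵥ ![w, 1] = (r : ℂ) • ![w, 1]) :
    A = r • (1 : Matrix (Fin 2) (Fin 2) ℝ) := by
  have h₀ : (A 0 0 : ℂ) * w + A 0 1 = r * w := by
    simpa [Matrix.mulVec, dotProduct] using congrFun h 0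
  have h₁ : (A 1 0 : ℂ) * w + A 1 1 = r := by
    simpa [Matrix.mulVec, dotProduct] using congrFun h 1
  have h00 : A 0 0 = r := by simpa [hw.ne'] using congrArg Complex.im h₀
  have h01 : A 0 1 = 0 := by simpa [h00] using congrArg Complex.re h₀
  have h10 : A 1 0 = 0 := by simpa [hw.ne'] using congrArg Complex.im h₁
  have h11 : A 1 1 = r := by simpa [h10] using congrArg Complex.re h₁
  ext i j
  fin_cases i <;> fin_cases j <;> simp [h00, h01, h10, h11]

lemma pow_mulVec_eq_smul {R n : Type*} [CommSemiring R] [Fintype n] [DecidableEq n]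
    {A : Matrix n n R} {v : n → R} {μ : R} (h : A *ᵥ v = μ • v) (m : ℕ) :
    (A ^ m) *ᵥ v = μ ^ m • v := by
  induction m with
  | zero => simp
  | succ m ih => rw [pow_succ, ← Matrix.mulVec_mulVec, h, Matrix.mulVec_smul, ih, smul_smul,
      pow_succ']

/-- A power of a matrix fixing `w ∈ ℍ` is scalar as soon as the same power of its automorphy
factor at `w` is real. -/
lemma pow_eq_smul_one_of_fixedPoint {γ : Matrix (Fin 2) (Fin 2) ℝ} {w : ℂ} (hw : 0 < w.im)
    (hfix : (γ 0 0 : ℂ) * w + γ 0 1 = ((γ 1 0 : ℂ) * w + γ 1 1) * w) {m : ℕ} {r : ℝ}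
    (hr : ((γ 1 0 : ℂ) * w + γ 1 1) ^ m = r) :
    γ ^ m = r • (1 : Matrix (Fin 2) (Fin 2) ℝ) := by
  apply eq_smul_one_of_mulVec hw
  have hmap : (γ ^ m).map ((↑) : ℝ → ℂ) = (γ.map ((↑) : ℝ → ℂ)) ^ m :=
    map_pow Complex.ofRealHom.mapMatrix γ m
  rw [hmap, ← hr]
  apply pow_mulVec_eq_smul
  ext i
  fin_cases i
  · simpa [Matrix.mulVec, dotProduct] using hfix
  · simp [Matrix.mulVec, dotProduct]

/-- If `F` is invariant under the weight-`2l` action of `γ` near a fixed point `w` and vanishes there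
to finite order `n`, then the automorphy factor `j` at `w` satisfies
`j ^ (2 (l + n)) = (det γ) ^ (l + n)`. -/
lemma automorphyFactor_pow_eq {γ : Matrix (Fin 2) (Fin 2) ℝ} (hdet : 0 < γ.det) {w : ℂ}
    (hw : 0 < w.im) (hfix : (γ 0 0 : ℂ) * w + γ 0 1 = ((γ 1 0 : ℂ) * w + γ 1 1) * w)
    {F g : ℂ → ℂ} {l n : ℕ} (hg : ContinuousAt g w) (hgw : g w ≠ 0)
    (hFg : ∀ᶠ z in nhds w, F z = (z - w) ^ n * g z)
    (hF : ∀ᶠ z in nhds w, ((γ 1 0 : ℂ) * z + γ 1 1) ^ (2 * l) * F z =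
      (γ.det : ℂ) ^ l * F (((γ 0 0 : ℂ) * z + γ 0 1) / ((γ 1 0 : ℂ) * z + γ 1 1))) :
    ((γ 1 0 : ℂ) * w + γ 1 1) ^ (2 * (l + n)) = (γ.det : ℂ) ^ (l + n) := by
  set j : ℂ → ℂ := fun z => (γ 1 0 : ℂ) * z + γ 1 1 with hj
  set M : ℂ → ℂ := fun z => ((γ 0 0 : ℂ) * z + γ 0 1) / j z with hM
  have hjw : j w ≠ 0 := denom_ne_zero_of_det_pos hdet hw
  have hMw : M w = w := by rw [hM, div_eq_iff hjw]; simpa only [mul_comm w] using hfix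
  have hj_cont : ContinuousAt j w := by fun_prop
  have hM_cont : ContinuousAt M w := ContinuousAt.div (by fun_prop) hj_cont hjw
  have hM_sub : ∀ z, j z ≠ 0 → (M z - w) * (j z * j w) = γ.det * (z - w) := by
    intro z hz
    have hMz : M z * j z = (γ 0 0 : ℂ) * z + γ 0 1 := div_mul_cancel₀ _ hz
    have hexp : (γ.det : ℂ) = γ 0 0 * γ 1 1 - γ 0 1 * γ 1 0 := by
      rw [Matrix.det_fin_two]; push_cast; ring
    rw [hexp]
    simp only [hj] at hMz hfix ⊢
    linear_combination ((γ 1 0 : ℂ) * w + γ 1 1) * hMz + ((γ 1 0 : ℂ) * z + γ 1 1) * hfix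
  have hFgM : ∀ᶠ z in nhds w, F (M z) = (M z - w) ^ n * g (M z) :=
    hM_cont.eventually (p := fun z => F z = (z - w) ^ n * g z) (by rw [hMw]; exact hFg)
  have hgM : ContinuousAt (fun z => g (M z)) w :=
    ContinuousAt.comp (by rwa [hMw]) hM_cont
  have hpunctured : (fun z => j z ^ (2 * l) * (j z * j w) ^ n * g z) =ᶠ[nhdsWithin w {w}ᶜ]
      fun z => (γ.det : ℂ) ^ (l + n) * g (M z) := by
    filter_upwards [nhdsWithin_le_nhds hFg, nhdsWithin_le_nhds hF, nhdsWithin_le_nhds hFgM,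
      nhdsWithin_le_nhds (hj_cont.eventually_ne hjw), self_mem_nhdsWithin]
      with z hz₁ hz₂ hz₃ hjz hzw
    have hpow : (z - w) ^ n ≠ 0 := pow_ne_zero n (sub_ne_zero.2 hzw)
    have hsub : (M z - w) ^ n * (j z * j w) ^ n = (γ.det : ℂ) ^ n * (z - w) ^ n := by
      rw [← mul_pow, hM_sub z hjz, mul_pow]
    have hinv : j z ^ (2 * l) * ((z - w) ^ n * g z) =
        (γ.det : ℂ) ^ l * ((M z - w) ^ n * g (M z)) := by rw [← hz₁, ← hz₃]; exact hz₂
    apply mul_left_cancel₀ hpow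
    rw [pow_add]
    linear_combination (j z * j w) ^ n * hinv + (γ.det : ℂ) ^ l * g (M z) * hsub
  have hlimit : j w ^ (2 * l) * (j w * j w) ^ n * g w = (γ.det : ℂ) ^ (l + n) * g (M w) :=
    ((ContinuousAt.eventuallyEq_nhds_iff_eventuallyEq_nhdsNE
      (by fun_prop) (continuousAt_const.mul hgM)).1 hpunctured).eq_of_nhds
  rw [hMw] at hlimit
  change j w ^ (2 * (l + n)) = _
  rw [← mul_right_cancel₀ hgw hlimit, ← sq, ← pow_mul, ← pow_add, mul_add]

open scoped Manifold in
/-- Weil's lemma: an elliptic matrix fixing a nonconstant holomorphic function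
under the slash action must have finite order (a power of it is scalar). -/
theorem weil_lemma (k : ℤ) (hk : 0 < k) (hke : Even k) (f : ℍ → ℂ)
    (hf : MDifferentiable 𝓘(ℂ) 𝓘(ℂ) f)
    (ε : Matrix (Fin 2) (Fin 2) ℝ) (hdet : 0 < ε.det)
    (hell : ε.trace ^ 2 < 4 * ε.det)
    (hfix : slash k ε f = f) :
    (∃ n : ℕ, 1 ≤ n ∧ ∃ c : ℝ, ε ^ n = c • (1 : Matrix (Fin 2) (Fin 2) ℝ)) ∨
      (∃ c : ℂ, ∀ z : ℍ, f z = c) := by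
  obtain ⟨w, hw, hwfix⟩ := exists_fixedPoint_of_elliptic hell
  have hFan : AnalyticOnNhd ℂ (f ∘ ofComplex) upperHalfPlaneSet :=
    (UpperHalfPlane.mdifferentiable_iff.1 hf).analyticOnNhd isOpen_upperHalfPlaneSet
  by_cases hzero : ∀ᶠ z in nhds w, (f ∘ ofComplex) z = 0
  · right
    refine ⟨0, fun z => ?_⟩
    have h := hFan.eqOn_zero_of_preconnected_of_eventuallyEq_zero
      (convex_halfSpace_im_gt 0).isPreconnected hw hzero z.im_pos
    simpa [ofComplex_apply] using h
  · left
    obtain ⟨n, g, hg, hgw, hFg⟩ := (hFan w hw).exists_eventuallyEq_pow_smul_nonzero_iff.2 hzero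
    obtain ⟨l, hl⟩ : ∃ l : ℕ, k = 2 * l := by
      obtain ⟨l, rfl⟩ := hke
      exact ⟨l.toNat, by omega⟩
    have hF : ∀ᶠ z in nhds w, ((ε 1 0 : ℂ) * z + ε 1 1) ^ (2 * l) * (f ∘ ofComplex) z =
        (ε.det : ℂ) ^ l * (f ∘ ofComplex)
          (((ε 0 0 : ℂ) * z + ε 0 1) / ((ε 1 0 : ℂ) * z + ε 1 1)) := by
      filter_upwards [isOpen_upperHalfPlaneSet.mem_nhds hw] with z hz
      have hjz := denom_ne_zero_of_det_pos hdet hz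
      lift z to ℍ using hz
      have hact := coe_act hdet z
      rw [moebius] at hact
      have h := congrFun hfix z
      rw [slash, hl, Int.mul_ediv_cancel_left _ two_ne_zero, zpow_natCast, _root_.zpow_neg] at h
      rw [← hact, Function.comp_apply, Function.comp_apply, ofComplex_apply, ofComplex_apply, ← h]
      have hcast : ((ε 1 0 : ℂ) * z + ε 1 1) ^ (2 * (l : ℤ)) =
          ((ε 1 0 : ℂ) * z + ε 1 1) ^ (2 * l) := by norm_cast
      rw [hcast]
      field_simp
    refine ⟨2 * (l + n), by omega, ε.det ^ (l + n), pow_eq_smul_one_of_fixedPoint hw hwfix ?_⟩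
    rw [automorphyFactor_pow_eq hdet hw hwfix hg.continuousAt hgw hFg hF]
    push_cast
    rfl
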